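/- arXiv:2302.02132 — 3 statements merged into one kernel-verified Lean document; each statement's English description precedes it below -/
import Mathlib

section
/- Let P be a finite nonempty labelled point set in ℝ^d that is in general position, and suppose the labelling c is not constant on P. Then the set rel(P) of relevant points is the unique minimum-cardinality reduced training set of (P,c): rel(P) is itself a reduced training set, and every reduced training set Q of (P,c) satisfies rel(P) ⊆ Q (hence |Q| ≥ |rel(P)|, with equality only for Q = rel(P)). -/
open Set

/-- The nearest-neighbor classification induced by a labelled point set `(P, c)` in `ℝ^d`:
`nnClass P c q` is the set of labels of nearest neighbors of `q` in `P`. -/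
def nnClass {d : ℕ} {L : Type*} (P : Set (EuclideanSpace ℝ (Fin d)))
    (c : EuclideanSpace ℝ (Fin d) → L) (q : EuclideanSpace ℝ (Fin d)) : Set L :=
  {l | ∃ p ∈ P, (∀ p' ∈ P, dist q p ≤ dist q p') ∧ c p = l}

/-- `Q` is a reduced training set of `(P, c)`. -/
def IsRTS {d : ℕ} {L : Type*} (P : Set (EuclideanSpace ℝ (Fin d)))
    (c : EuclideanSpace ℝ (Fin d) → L) (Q : Set (EuclideanSpace ℝ (Fin d))) : Prop :=
  Q ⊆ P ∧ nnClass Q c = nnClass P c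

/-- The set of relevant points of `(P, c)`. -/
def relPts {d : ℕ} {L : Type*} (P : Set (EuclideanSpace ℝ (Fin d)))
    (c : EuclideanSpace ℝ (Fin d) → L) : Set (EuclideanSpace ℝ (Fin d)) :=
  {p | p ∈ P ∧ nnClass (P \ {p}) c ≠ nnClass P c}

/-- `P` is in general position: no three points of `P` are collinear
and no four points of `P` are concyclic. -/
def GenPos {d : ℕ} (P : Set (EuclideanSpace ℝ (Fin d))) : Prop :=
  (∀ s ⊆ P, s.ncard = 3 → ¬ Collinear ℝ s) ∧
  (∀ s ⊆ P, s.ncard = 4 → ¬ EuclideanGeometry.Concyclic s)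

/-- The bisecting hyperplane (perpendicular bisector) of two points. -/
def bis {d : ℕ} (a b : EuclideanSpace ℝ (Fin d)) : Set (EuclideanSpace ℝ (Fin d)) :=
  {x | dist x a = dist x b}

section NearestNeighbors

variable {V : Type*} [PseudoMetricSpace V]

/-- The nearest neighbors of `x` in `P`. -/
def nearestPts (P : Set V) (x : V) : Set V :=
  {p | p ∈ P ∧ ∀ p' ∈ P, dist x p ≤ dist x p'}

/-- The points strictly closer to `p` than to any other point of `P`. -/
def strictCell (P : Set V) (p : V) : Set V :=
  {x | ∀ p' ∈ P, p' ≠ p → dist x p < dist x p'}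

/-- The points that, for some `x`, are one of exactly two nearest neighbors of `x` in `P`, the two
having different labels. -/
def wallPts {L : Type*} (P : Set V) (c : V → L) : Set V :=
  {p | ∃ x q, nearestPts P x = {p, q} ∧ c p ≠ c q}

lemma dist_eq_of_mem_nearestPts {P : Set V} {x p q : V} (hp : p ∈ nearestPts P x)
    (hq : q ∈ nearestPts P x) : dist x p = dist x q :=
  le_antisymm (hp.2 q hq.1) (hq.2 p hp.1)

lemma nearestPts_nonempty {P : Set V} (hP : P.Finite) (hne : P.Nonempty) (x : V) :
    (nearestPts P x).Nonempty := by
  obtain ⟨p, hp, h⟩ := Set.exists_min_image P (fun p => dist x p) hP hne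
  exact ⟨p, hp, h⟩

lemma nearestPts_eq_of_mem_strictCell {P : Set V} {p x : V} (hp : p ∈ P)
    (hx : x ∈ strictCell P p) : nearestPts P x = {p} := by
  ext r
  constructor
  · rintro ⟨hr, h⟩
    by_contra hne
    exact absurd (h p hp) (not_le.2 (hx r hr hne))
  · rintro rfl
    refine ⟨hp, fun r' hr' => ?_⟩
    rcases eq_or_ne r' r with rfl | h
    · exact le_rfl
    · exact (hx r' hr' h).le

lemma isOpen_strictCell {P : Set V} (hP : P.Finite) (p : V) : IsOpen (strictCell P p) := by
  have : strictCell P p = ⋂ p' ∈ P, {x | p' ≠ p → dist x p < dist x p'} := by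
    ext x; simp [strictCell]
  rw [this]
  refine hP.isOpen_biInter fun p' _ => ?_
  by_cases h : p' = p
  · simp [h]
  · simpa [h] using isOpen_lt (by fun_prop) (by fun_prop)

lemma isClosed_setOf_mem_nearestPts (P : Set V) (p : V) : IsClosed {x | p ∈ nearestPts P x} := by
  have : {x | p ∈ nearestPts P x} = {_x | p ∈ P} ∩ ⋂ p' ∈ P, {x | dist x p ≤ dist x p'} := by
    ext x; simp [nearestPts]
  rw [this]
  exact isClosed_const.inter
    (isClosed_biInter fun p' _ => isClosed_le (by fun_prop) (by fun_prop))

lemma eventually_nearestPts_subset {P : Set V} (hP : P.Finite) (x : V) :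
    ∀ᶠ y in nhds x, nearestPts P y ⊆ nearestPts P x := by
  have : ∀ᶠ y in nhds x, ∀ p ∈ P, p ∈ nearestPts P y → p ∈ nearestPts P x := by
    rw [Filter.eventually_all_finite hP]
    intro p _
    by_cases hpx : p ∈ nearestPts P x
    · simp [hpx]
    · filter_upwards [(isClosed_setOf_mem_nearestPts P p).isOpen_compl.mem_nhds hpx] with y hy h
      exact absurd h hy
  filter_upwards [this] with y hy p hp
  exact hy p hp.1 hp

end NearestNeighbors

section InnerProduct

variable {V : Type*} [NormedAddCommGroup V] [InnerProductSpace ℝ V]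

lemma dist_sq_eq_inner (x p : V) : dist x p ^ 2 = ‖x‖ ^ 2 - 2 * inner ℝ x p + ‖p‖ ^ 2 := by
  rw [dist_eq_norm, norm_sub_sq_real]

lemma dist_le_dist_iff_inner (x p q : V) :
    dist x p ≤ dist x q ↔ ‖p‖ ^ 2 - ‖q‖ ^ 2 ≤ 2 * inner ℝ x (p - q) := by
  rw [← sq_le_sq₀ dist_nonneg dist_nonneg, dist_sq_eq_inner, dist_sq_eq_inner, inner_sub_right]
  constructor <;> intro h <;> linarith

lemma dist_lt_dist_iff_inner (x p q : V) :
    dist x p < dist x q ↔ ‖p‖ ^ 2 - ‖q‖ ^ 2 < 2 * inner ℝ x (p - q) := by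
  rw [← sq_lt_sq₀ dist_nonneg dist_nonneg, dist_sq_eq_inner, dist_sq_eq_inner, inner_sub_right]
  constructor <;> intro h <;> linarith

lemma dist_eq_dist_iff_inner (x p q : V) :
    dist x p = dist x q ↔ inner ℝ x (p - q) = (‖p‖ ^ 2 - ‖q‖ ^ 2) / 2 := by
  rw [← sq_eq_sq₀ dist_nonneg dist_nonneg, dist_sq_eq_inner, dist_sq_eq_inner, inner_sub_right]
  constructor <;> intro h <;> linarith

lemma convex_strictCell (P : Set V) (p : V) : Convex ℝ (strictCell P p) := by
  intro x hx y hy a b ha hb hab p' hp' hne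
  have h1 := (dist_lt_dist_iff_inner _ _ _).1 (hx p' hp' hne)
  have h2 := (dist_lt_dist_iff_inner _ _ _).1 (hy p' hp' hne)
  rw [dist_lt_dist_iff_inner, inner_add_left, real_inner_smul_left, real_inner_smul_left]
  obtain rfl : b = 1 - a := by linarith
  rcases ha.eq_or_lt with rfl | ha
  · linarith
  · nlinarith [mul_lt_mul_of_pos_left h1 ha, mul_le_mul_of_nonneg_left h2.le hb]

lemma mem_strictCell_of_pos {P : Set V} {x p : V} (hp : p ∈ nearestPts P x) {t : ℝ} (ht : 0 < t)
    (ht1 : t ≤ 1) : x + t • (p - x) ∈ strictCell P p := by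
  intro p' hp' hne
  have h1 := (dist_le_dist_iff_inner _ _ _).1 (hp.2 p' hp')
  have h2 : 0 < dist p p' ^ 2 := pow_pos (dist_pos.2 hne.symm) 2
  rw [dist_sq_eq_inner] at h2
  rw [dist_lt_dist_iff_inner, inner_add_left, real_inner_smul_left, inner_sub_left]
  have h3 : inner ℝ p (p - p') = ‖p‖ ^ 2 - inner ℝ p p' := by
    rw [inner_sub_right, real_inner_self_eq_norm_sq]
  rw [h3]
  nlinarith [mul_pos ht h2, mul_le_mul_of_nonneg_left h1 (sub_nonneg.2 ht1)]

lemma exists_mem_strictCell {P U : Set V} {x p : V} (hU : U ∈ nhds x) (hp : p ∈ nearestPts P x) :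
    ∃ y ∈ U, y ∈ strictCell P p := by
  have hc : ContinuousAt (fun t : ℝ => x + t • (p - x)) 0 := by fun_prop
  have h0 : ∀ᶠ t : ℝ in nhdsWithin 0 (Set.Ioi 0), x + t • (p - x) ∈ U :=
    nhdsWithin_le_nhds (hc (by simpa using hU))
  have h1 : ∀ᶠ t : ℝ in nhdsWithin 0 (Set.Ioi 0), t ∈ Set.Ioc (0 : ℝ) 1 :=
    Ioc_mem_nhdsGT one_pos
  obtain ⟨t, h, ht⟩ := (h0.and h1).exists
  exact ⟨_, h, mem_strictCell_of_pos hp ht.1 ht.2⟩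

lemma dense_setOf_inner_ne {w : V} (hw : w ≠ 0) (k : ℝ) : Dense {x : V | inner ℝ x w ≠ k} := by
  intro x
  rw [mem_closure_iff_nhds]
  intro U hU
  by_cases hx : inner ℝ x w = k
  · have hc : ContinuousAt (fun t : ℝ => x + t • w) 0 := by fun_prop
    have h0 : ∀ᶠ t : ℝ in nhdsWithin 0 (Set.Ioi 0), x + t • w ∈ U :=
      nhdsWithin_le_nhds (hc (by simpa using hU))
    obtain ⟨t, h, ht⟩ := (h0.and self_mem_nhdsWithin).exists
    refine ⟨_, h, ?_⟩
    have ht : 0 < t := ht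
    have := mul_pos ht (real_inner_self_pos.2 hw)
    simp only [Set.mem_ofPred_eq, inner_add_left, real_inner_smul_left, hx]
    linarith
  · exact ⟨x, mem_of_mem_nhds hU, hx⟩

lemma exists_mem_forall_inner_ne [CompleteSpace V] {O : Set V} (hO : IsOpen O) (hne : O.Nonempty)
    {S : Set (V × ℝ)} (hS : S.Finite) (h0 : ∀ s ∈ S, s.1 ≠ 0) :
    ∃ x ∈ O, ∀ s ∈ S, inner ℝ x s.1 ≠ s.2 := by
  have hd : Dense (⋂ s ∈ S, {x : V | inner ℝ x s.1 ≠ s.2}) := by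
    refine dense_biInter_of_isOpen (fun s _ => ?_) hS.countable
      fun s hs => dense_setOf_inner_ne (h0 s hs) s.2
    exact isOpen_ne_fun (by fun_prop) (by fun_prop)
  obtain ⟨x, hxO, hx⟩ := hd.inter_open_nonempty O hO hne
  exact ⟨x, hxO, by simpa using hx⟩

/-- In a set without collinear triples, the differences of a point with two others are not
proportional. -/
lemma smul_sub_ne_smul_sub {P : Set V} (hP : ∀ s ⊆ P, s.ncard = 3 → ¬ Collinear ℝ s) {p q r : V}
    (hp : p ∈ P) (hq : q ∈ P) (hr : r ∈ P) (hpq : p ≠ q) (hpr : p ≠ r) (hqr : q ≠ r) {A : ℝ}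
    (hA : A ≠ 0) (B : ℝ) : A • (p - r) ≠ B • (p - q) := by
  intro h
  refine hP {p, q, r} (by simp [Set.insert_subset_iff, *])
    (Set.ncard_eq_three.2 ⟨p, q, r, hpq, hpr, hqr, rfl⟩) ?_
  rw [collinear_iff_of_mem (p₀ := p) (by simp)]
  refine ⟨p - q, ?_⟩
  simp only [Set.mem_insert_iff, Set.mem_singleton_iff, vadd_eq_add]
  rintro s (rfl | rfl | rfl)
  · exact ⟨0, by simp⟩
  · exact ⟨-1, by simp⟩
  · refine ⟨-(A⁻¹ * B), ?_⟩
    rw [neg_smul, mul_smul, ← h, smul_smul, inv_mul_cancel₀ hA]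
    simp

lemma exists_nearestPts_eq_pair [CompleteSpace V] {L : Type*} {P U : Set V} (c : V → L)
    (hP : P.Finite) (hcol : ∀ s ⊆ P, s.ncard = 3 → ¬ Collinear ℝ s) (hU : IsOpen U)
    (hUc : Convex ℝ U) {x₁ x₂ p₁ p₂ : V} (hx₁ : x₁ ∈ U) (hx₂ : x₂ ∈ U)
    (hp₁ : p₁ ∈ nearestPts P x₁) (hp₂ : p₂ ∈ nearestPts P x₂) (hc : c p₁ ≠ c p₂) :
    ∃ z ∈ U, ∃ r₁ r₂, nearestPts P z = {r₁, r₂} ∧ c r₁ ≠ c r₂ := by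
  obtain ⟨a, ⟨haU, haS⟩, ha⟩ := exists_mem_forall_inner_ne (hU.inter (isOpen_strictCell hP p₁))
    (exists_mem_strictCell (hU.mem_nhds hx₁) hp₁)
    (S := (fun s : V × V => (s.1 - s.2, (‖s.1‖ ^ 2 - ‖s.2‖ ^ 2) / 2)) '' (P ×ˢ P \ {s | s.1 = s.2}))
    (((hP.prod hP).sdiff).image _)
    (by rintro _ ⟨s, hs, rfl⟩; exact sub_ne_zero.2 hs.2)
  have ha' : ∀ p ∈ P, ∀ q ∈ P, p ≠ q → inner ℝ a (p - q) - (‖p‖ ^ 2 - ‖q‖ ^ 2) / 2 ≠ 0 :=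
    fun p hp q hq hpq => sub_ne_zero.2 (ha _ ⟨(p, q), ⟨⟨hp, hq⟩, hpq⟩, rfl⟩)
  let g : V → V → ℝ := fun p q => inner ℝ a (p - q) - (‖p‖ ^ 2 - ‖q‖ ^ 2) / 2
  let w : V × V × V → V := fun s => g s.1 s.2.1 • (s.1 - s.2.2) - g s.1 s.2.2 • (s.1 - s.2.1)
  obtain ⟨b, ⟨hbU, hbS⟩, hb⟩ := exists_mem_forall_inner_ne (hU.inter (isOpen_strictCell hP p₂))
    (exists_mem_strictCell (hU.mem_nhds hx₂) hp₂)
    (S := (fun s => (w s, inner ℝ a (w s))) '' (P ×ˢ P ×ˢ P \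
      {s | s.1 = s.2.1 ∨ s.1 = s.2.2 ∨ s.2.1 = s.2.2}))
    (((hP.prod (hP.prod hP)).sdiff).image _)
    (by
      rintro _ ⟨⟨p, q, r⟩, ⟨⟨hp, hq, hr⟩, hs⟩, rfl⟩
      simp only [Set.mem_ofPred_eq, not_or] at hs
      exact sub_ne_zero.2 (smul_sub_ne_smul_sub hcol hp hq hr hs.1 hs.2.1 hs.2.2
        (ha' p hp q hq hs.1) _))
  have hconn : IsPreconnected (segment ℝ a b) := (convex_segment a b).isPreconnected
  have hclosed : ∀ T : Set V, T ⊆ P → IsClosed (⋃ p ∈ T, {x | p ∈ nearestPts P x}) :=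
    fun T hT => (hP.subset hT).isClosed_biUnion fun p _ => isClosed_setOf_mem_nearestPts P p
  obtain ⟨z, hz, hz₁, hz₂⟩ := isPreconnected_closed_iff.1 hconn _ _
    (hclosed {p ∈ P | c p = c p₁} (Set.sep_subset _ _))
    (hclosed {p ∈ P | c p ≠ c p₁} (Set.sep_subset _ _))
    (fun x _ => by
      obtain ⟨p, hp⟩ := nearestPts_nonempty hP ⟨p₁, hp₁.1⟩ x
      by_cases h : c p = c p₁
      · exact Or.inl (Set.mem_biUnion (x := p) ⟨hp.1, h⟩ hp)
      · exact Or.inr (Set.mem_biUnion (x := p) ⟨hp.1, h⟩ hp))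
    ⟨a, left_mem_segment ℝ a b, Set.mem_biUnion (x := p₁) ⟨hp₁.1, rfl⟩
      (by simp [nearestPts_eq_of_mem_strictCell hp₁.1 haS])⟩
    ⟨b, right_mem_segment ℝ a b, Set.mem_biUnion (x := p₂) ⟨hp₂.1, hc.symm⟩
      (by simp [nearestPts_eq_of_mem_strictCell hp₂.1 hbS])⟩
  obtain ⟨r₁, ⟨hr₁, hcr₁⟩, hr₁z⟩ := Set.mem_iUnion₂.1 hz₁
  obtain ⟨r₂, ⟨hr₂, hcr₂⟩, hr₂z⟩ := Set.mem_iUnion₂.1 hz₂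
  have hcr : c r₁ ≠ c r₂ := fun h => hcr₂ (h ▸ hcr₁)
  refine ⟨z, hUc.segment_subset haU hbU hz, r₁, r₂, Set.Subset.antisymm (fun r hr => ?_) ?_, hcr⟩
  · by_contra hne
    simp only [Set.mem_insert_iff, Set.mem_singleton_iff, not_or] at hne
    have h12 : r₁ ≠ r₂ := fun h => hcr (h ▸ rfl)
    have e1 := (dist_eq_dist_iff_inner _ _ _).1 (dist_eq_of_mem_nearestPts hr₁z hr₂z)
    have e2 := (dist_eq_dist_iff_inner _ _ _).1 (dist_eq_of_mem_nearestPts hr₁z hr)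
    refine hb _ ⟨(r₁, r₂, r), ⟨⟨hr₁, hr₂, hr.1⟩, ?_⟩, rfl⟩ ?_
    · simp only [Set.mem_ofPred_eq, not_or]
      exact ⟨h12, Ne.symm hne.1, Ne.symm hne.2⟩
    · rw [segment_eq_image'] at hz
      obtain ⟨t, -, rfl⟩ := hz
      simp only [inner_add_left, real_inner_smul_left, inner_sub_left] at e1 e2
      simp only [w, g, inner_sub_right (𝕜 := ℝ) _ (_ • _), real_inner_smul_right, ← e1, ← e2]
      ring
  · rintro r (rfl | rfl)
    exacts [hr₁z, hr₂z]

end InnerProduct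

section Bisectors

variable {V : Type*} [NormedAddCommGroup V] [InnerProductSpace ℝ V]

lemma exists_eq_smul_of_eventually_inner_nonneg_iff {u u' : V} (hu : u ≠ 0)
    (h : ∀ᶠ v in nhds (0 : V), 0 ≤ inner ℝ v u ↔ 0 ≤ inner ℝ v u') : ∃ k : ℝ, u' = k • u := by
  have hall : ∀ v : V, 0 ≤ inner ℝ v u ↔ 0 ≤ inner ℝ v u' := by
    intro v
    have hc : Filter.Tendsto (fun t : ℝ => t • v) (nhdsWithin 0 (Set.Ioi 0)) (nhds 0) := by
      have : ContinuousAt (fun t : ℝ => t • v) 0 := by fun_prop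
      simpa [ContinuousAt] using this.tendsto.mono_left nhdsWithin_le_nhds
    obtain ⟨t, ht, ht0⟩ := ((hc.eventually h).and self_mem_nhdsWithin).exists
    have ht0 : 0 < t := ht0
    simpa [real_inner_smul_left, mul_nonneg_iff_of_pos_left ht0] using ht
  have hu0 : inner ℝ u u ≠ 0 := (real_inner_self_pos.2 hu).ne'
  set v : V := u' - (inner ℝ u' u / inner ℝ u u) • u with hv
  have hvu : inner ℝ v u = 0 := by
    rw [hv, inner_sub_left, real_inner_smul_left]
    field_simp
    ring
  have h1 : 0 ≤ inner ℝ v u' := (hall v).1 hvu.ge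
  have h2 : 0 ≤ inner ℝ (-v) u' := (hall (-v)).1 (by rw [inner_neg_left, hvu, neg_zero])
  rw [inner_neg_left] at h2
  have hvv : inner ℝ v v = 0 := by
    nth_rewrite 2 [hv]
    rw [inner_sub_right, real_inner_smul_right, hvu]
    linarith
  exact ⟨_, sub_eq_zero.1 (inner_self_eq_zero.1 hvv)⟩

lemma inner_midpoint_sub (p q : V) :
    inner ℝ ((1 / 2 : ℝ) • (p + q)) (p - q) = (‖p‖ ^ 2 - ‖q‖ ^ 2) / 2 := by
  rw [real_inner_smul_left, inner_add_left, inner_sub_right, inner_sub_right,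
    real_inner_self_eq_norm_sq, real_inner_self_eq_norm_sq, real_inner_comm p q]
  ring

/-- Two parallel segments with a common bisecting hyperplane have concyclic endpoints, unless
they have the same midpoint. -/
lemma concyclic_of_sub_eq_smul_sub {p q p' q' w : V} {k : ℝ} (hk : k ≠ 0)
    (hpar : p' - q' = k • (p - q)) (hw : dist w p = dist w q) (hw' : dist w p' = dist w q')
    (hmid : p' + q' ≠ p + q) : EuclideanGeometry.Concyclic ({q', p', p, q} : Set V) := by
  set D : V := (1 / 2 : ℝ) • (p' + q') - (1 / 2 : ℝ) • (p + q) with hD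
  have hDne : D ≠ 0 := by
    rw [hD, ← smul_sub]
    exact smul_ne_zero (by norm_num) (sub_ne_zero.2 hmid)
  rw [dist_eq_dist_iff_inner] at hw hw'
  have hDu : inner ℝ D (p - q) = 0 := by
    have h1 := inner_midpoint_sub p' q'
    rw [← hw', hpar, real_inner_smul_right, real_inner_smul_right] at h1
    rw [hD, inner_sub_left, mul_left_cancel₀ hk h1, inner_midpoint_sub, hw, sub_self]
  have hDp : inner ℝ D (p - p') ≠ 0 := by
    have : p - p' = ((1 - k) / 2) • (p - q) - D := by
      have : p - p' = (1 / 2 : ℝ) • (p - q) - (1 / 2 : ℝ) • (p' - q') - D := by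
        rw [hD]; module
      rw [this, hpar]; module
    rw [this, inner_sub_right, real_inner_smul_right, hDu, mul_zero, zero_sub, neg_ne_zero]
    exact (real_inner_self_pos.2 hDne).ne'
  set s : ℝ := ((‖p‖ ^ 2 - ‖p'‖ ^ 2) / 2 - inner ℝ w (p - p')) / inner ℝ D (p - p') with hs
  have e1 : dist (w + s • D) p = dist (w + s • D) q := by
    rw [dist_eq_dist_iff_inner, inner_add_left, real_inner_smul_left, hDu, hw]; ring
  have e2 : dist (w + s • D) p' = dist (w + s • D) q' := by
    rw [dist_eq_dist_iff_inner, inner_add_left, real_inner_smul_left, hw', hpar,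
      real_inner_smul_right, hDu]
    ring
  have e3 : dist (w + s • D) p = dist (w + s • D) p' := by
    rw [dist_eq_dist_iff_inner, inner_add_left, real_inner_smul_left, hs, div_mul_cancel₀ _ hDp]
    ring
  refine ⟨⟨w + s • D, dist (w + s • D) p, ?_⟩, ?_⟩
  · simp only [Set.mem_insert_iff, Set.mem_singleton_iff]
    rintro r (rfl | rfl | rfl | rfl)
    · rw [dist_comm, ← e2, ← e3]
    · rw [dist_comm, ← e3]
    · rw [dist_comm]
    · rw [dist_comm, ← e1]
  · have hq' : q' = (-k) • (p -ᵥ q) +ᵥ p' := by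
      rw [vsub_eq_sub, vadd_eq_add, neg_smul, ← hpar]; abel
    rw [coplanar_insert_iff_of_mem_affineSpan]
    · exact coplanar_triple ℝ p' p q
    · rw [hq']
      apply AffineSubspace.smul_vsub_vadd_mem <;> exact mem_affineSpan ℝ (by simp)

lemma mem_pair_of_sub_eq_smul_sub {P : Set V} (hcol : ∀ s ⊆ P, s.ncard = 3 → ¬ Collinear ℝ s)
    (hcyc : ∀ s ⊆ P, s.ncard = 4 → ¬ EuclideanGeometry.Concyclic s) {p q p' q' w : V}
    (hp : p ∈ P) (hq : q ∈ P) (hp' : p' ∈ P) (hq' : q' ∈ P) (hpq : p ≠ q) (hpq' : p' ≠ q') {k : ℝ}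
    (hpar : p' - q' = k • (p - q)) (hw : dist w p = dist w q) (hw' : dist w p' = dist w q') :
    p = p' ∨ p = q' := by
  by_contra! hne
  obtain ⟨h1, h2⟩ := hne
  by_cases h3 : q = p'
  · subst h3
    refine smul_sub_ne_smul_sub hcol hq hp hq' hpq.symm hpq' h2 one_ne_zero (-k) ?_
    rw [one_smul, hpar]; module
  by_cases h4 : q = q'
  · subst h4
    refine smul_sub_ne_smul_sub hcol hq hp hp' hpq.symm h3 h1 one_ne_zero k ?_
    rw [one_smul, ← neg_sub p' q, hpar]; module
  refine hcyc {q', p', p, q} (by simp [Set.insert_subset_iff, *]) (Set.ncard_eq_four.2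
    ⟨q', p', p, q, hpq'.symm, h2.symm, Ne.symm h4, h1.symm, Ne.symm h3, hpq, rfl⟩)
    (concyclic_of_sub_eq_smul_sub ?_ hpar hw hw' fun hmid => ?_)
  · rintro rfl
    exact hpq' (sub_eq_zero.1 (by rw [hpar, zero_smul]))
  · refine smul_sub_ne_smul_sub hcol hp hq hp' hpq h1 h3 two_ne_zero (1 - k) ?_
    rw [sub_smul, ← hpar, one_smul, ← sub_eq_zero,
      show (2 : ℝ) • (p - p') - (p - q - (p' - q')) = (p + q) - (p' + q') by module, hmid, sub_self]

end Bisectors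

section ReducedTrainingSets

variable {V : Type*} [NormedAddCommGroup V] [InnerProductSpace ℝ V] [CompleteSpace V] {L : Type*}
  {P Q : Set V} {c : V → L}

lemma wallPts_subset_of_image_nearestPts_eq (hP : P.Finite)
    (hcol : ∀ s ⊆ P, s.ncard = 3 → ¬ Collinear ℝ s)
    (hcyc : ∀ s ⊆ P, s.ncard = 4 → ¬ EuclideanGeometry.Concyclic s) (hQP : Q ⊆ P)
    (hQ : ∀ x, c '' nearestPts Q x = c '' nearestPts P x) : wallPts P c ⊆ Q := by
  rintro p ⟨z, q, hz, hc⟩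
  obtain ⟨p₀, hp₀, hcp₀⟩ : c p ∈ c '' nearestPts Q z := by
    rw [hQ, hz]; exact ⟨p, by simp, rfl⟩
  obtain ⟨q₀, hq₀, hcq₀⟩ : c q ∈ c '' nearestPts Q z := by
    rw [hQ, hz]; exact ⟨q, by simp, rfl⟩
  have hp : p ∈ P := (show p ∈ nearestPts P z by simp [hz]).1
  have hq : q ∈ P := (show q ∈ nearestPts P z by simp [hz]).1
  obtain ⟨ε, hε, hball⟩ := Metric.eventually_nhds_iff_ball.1 (eventually_nearestPts_subset hP z)
  obtain ⟨w, hw, r₁, r₂, hr, hcr⟩ := exists_nearestPts_eq_pair c (hP.subset hQP)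
    (fun s hs => hcol s (hs.trans hQP)) Metric.isOpen_ball (convex_ball z ε)
    (Metric.mem_ball_self hε) (Metric.mem_ball_self hε) hp₀ hq₀ (by rwa [hcp₀, hcq₀])
  have hwP : nearestPts P w ⊆ {p, q} := hz ▸ hball w hw
  obtain ⟨p', q', hN, hcp', hcq', hpw, hqw⟩ : ∃ p' q', nearestPts Q w = {p', q'} ∧ c p' = c p ∧
      c q' = c q ∧ p ∈ nearestPts P w ∧ q ∈ nearestPts P w := by
    obtain ⟨a, ha, hca⟩ : c r₁ ∈ c '' nearestPts P w := by
      rw [← hQ, hr]; exact ⟨r₁, by simp, rfl⟩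
    obtain ⟨b, hb, hcb⟩ : c r₂ ∈ c '' nearestPts P w := by
      rw [← hQ, hr]; exact ⟨r₂, by simp, rfl⟩
    rcases hwP ha with rfl | rfl <;> rcases hwP hb with rfl | rfl
    · exact absurd (hca.symm.trans hcb) hcr
    · exact ⟨r₁, r₂, hr, hca.symm, hcb.symm, ha, hb⟩
    · exact ⟨r₂, r₁, by rw [hr, Set.pair_comm], hcb.symm, hca.symm, hb, ha⟩
    · exact absurd (hca.symm.trans hcb) hcr
  have hp'w : p' ∈ nearestPts Q w := by simp [hN]
  have hq'w : q' ∈ nearestPts Q w := by simp [hN]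
  have key : ∀ {T : Set V} {y a b : V}, T.Finite → a ∈ T → b ∈ T → nearestPts T y ⊆ {a, b} →
      c a ≠ c b → (c a ∈ c '' nearestPts T y ↔ dist y a ≤ dist y b) := by
    intro T y a b hT ha hb hab hcab
    have hmem : c a ∈ c '' nearestPts T y ↔ a ∈ nearestPts T y := by
      refine ⟨?_, fun h => ⟨a, h, rfl⟩⟩
      rintro ⟨r, hr, hcr⟩
      rcases hab hr with rfl | rfl
      exacts [hr, absurd hcr hcab.symm]
    rw [hmem]
    refine ⟨fun h => h.2 b hb, fun h => ?_⟩
    obtain ⟨r, hr⟩ := nearestPts_nonempty hT ⟨a, ha⟩ y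
    rcases hab hr with rfl | rfl
    · exact hr
    · exact ⟨ha, fun p' hp' => h.trans (hr.2 p' hp')⟩
  have hloc : ∀ᶠ y in nhds w, (dist y p ≤ dist y q ↔ dist y p' ≤ dist y q') := by
    filter_upwards [eventually_nearestPts_subset hP w,
      eventually_nearestPts_subset (hP.subset hQP) w] with y hyP hyQ
    rw [← key hP hp hq (hyP.trans hwP) hc,
      ← key (hP.subset hQP) hp'w.1 hq'w.1 (hN ▸ hyQ) (by rwa [hcp', hcq']), hQ, hcp']
  have e1 := dist_eq_of_mem_nearestPts hpw hqw
  have e2 := dist_eq_of_mem_nearestPts hp'w hq'w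
  have hpq : p ≠ q := fun h => hc (h ▸ rfl)
  have hpq' : p' ≠ q' := fun h => hc (by rw [← hcp', ← hcq', h])
  obtain ⟨k, hk⟩ := exists_eq_smul_of_eventually_inner_nonneg_iff (u := p - q) (u' := p' - q')
    (sub_ne_zero.2 hpq) (by
      have hc0 : Filter.Tendsto (fun v : V => w + v) (nhds 0) (nhds w) := by
        simpa [ContinuousAt] using (by fun_prop : ContinuousAt (fun v : V => w + v) 0)
      filter_upwards [hc0.eventually hloc] with v hv
      have e1' := (dist_eq_dist_iff_inner _ _ _).1 e1
      have e2' := (dist_eq_dist_iff_inner _ _ _).1 e2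
      rw [dist_le_dist_iff_inner, dist_le_dist_iff_inner, inner_add_left, inner_add_left, e1',
        e2'] at hv
      constructor
      · intro h
        linarith [hv.1 (by linarith)]
      · intro h
        linarith [hv.2 (by linarith)])
  rcases mem_pair_of_sub_eq_smul_sub hcol hcyc hp hq (hQP hp'w.1) (hQP hq'w.1) hpq hpq' hk e1 e2
    with h | h
  exacts [h ▸ hp'w.1, h ▸ hq'w.1]

lemma label_eq_of_mem_strictCell (hP : P.Finite)
    (hcol : ∀ s ⊆ P, s.ncard = 3 → ¬ Collinear ℝ s) (hQP : Q ⊆ P) (hW : wallPts P c ⊆ Q)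
    {p q x : V} (hq : q ∈ Q) (hx : x ∈ strictCell Q q) (hp : p ∈ nearestPts P x) : c p = c q := by
  by_contra hc
  have hqq : q ∈ nearestPts P q := ⟨hQP hq, fun p' _ => by simp⟩
  have hqc : q ∈ strictCell Q q := fun p' _ hne => by simpa using hne.symm
  obtain ⟨z, hz, r₁, r₂, hr, hcr⟩ := exists_nearestPts_eq_pair c hP hcol
    (isOpen_strictCell (hP.subset hQP) q) (convex_strictCell Q q) hx hqc hp hqq hc
  have h1 : r₁ ∈ nearestPts P z := by simp [hr]
  have h2 : r₂ ∈ nearestPts P z := by simp [hr]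
  have key : ∀ r ∈ Q, r ∈ nearestPts P z → r = q := fun r hrQ hrz => by
    by_contra hne
    exact absurd (hrz.2 q (hQP hq)) (not_le.2 (hz r hrQ hne))
  refine hcr ?_
  rw [key r₁ (hW ⟨z, r₂, hr, hcr⟩) h1, key r₂ (hW ⟨z, r₁, by rw [hr, Set.pair_comm], hcr.symm⟩) h2]

lemma image_nearestPts_eq_of_wallPts_subset (hP : P.Finite)
    (hcol : ∀ s ⊆ P, s.ncard = 3 → ¬ Collinear ℝ s) (hQP : Q ⊆ P) (hQ : Q.Nonempty)
    (hW : wallPts P c ⊆ Q) (x : V) : c '' nearestPts Q x = c '' nearestPts P x := by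
  have hQf := hP.subset hQP
  apply Set.Subset.antisymm
  · rintro _ ⟨q, hq, rfl⟩
    obtain ⟨y, hy, hyq⟩ := exists_mem_strictCell (eventually_nearestPts_subset hP x) hq
    obtain ⟨p, hp⟩ := nearestPts_nonempty hP (hQ.mono hQP) y
    exact ⟨p, hy hp, label_eq_of_mem_strictCell hP hcol hQP hW hq.1 hyq hp⟩
  · rintro _ ⟨p, hp, rfl⟩
    obtain ⟨y, hy, hyp⟩ := exists_mem_strictCell (eventually_nearestPts_subset hQf x) hp
    obtain ⟨q, hq⟩ := nearestPts_nonempty hQf hQ y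
    obtain ⟨y', hy', hyq⟩ := exists_mem_strictCell ((isOpen_strictCell hP p).mem_nhds hyp) hq
    refine ⟨q, hy hq, (label_eq_of_mem_strictCell hP hcol hQP hW hq.1 hyq ?_).symm⟩
    rw [nearestPts_eq_of_mem_strictCell hp.1 hy']
    exact rfl

end ReducedTrainingSets

lemma nnClass_eq_image_nearestPts {d : ℕ} {L : Type*} (P : Set (EuclideanSpace ℝ (Fin d)))
    (c : EuclideanSpace ℝ (Fin d) → L) (x : EuclideanSpace ℝ (Fin d)) :
    nnClass P c x = c '' nearestPts P x := by
  ext l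
  simp [nnClass, nearestPts, and_assoc]

lemma nnClass_eq_iff {d : ℕ} {L : Type*} {P Q : Set (EuclideanSpace ℝ (Fin d))}
    {c : EuclideanSpace ℝ (Fin d) → L} :
    nnClass Q c = nnClass P c ↔ ∀ x, c '' nearestPts Q x = c '' nearestPts P x := by
  simp [funext_iff, nnClass_eq_image_nearestPts]

/-- For a finite nonempty labelled point set in general position with non-constant labelling,
the set of relevant points is the unique minimum-cardinality reduced training set. -/
theorem relPts_unique_min_RTS {d : ℕ} (hd : 1 ≤ d) {L : Type*}
    (P : Set (EuclideanSpace ℝ (Fin d))) (c : EuclideanSpace ℝ (Fin d) → L)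
    (hfin : P.Finite) (hne : P.Nonempty) (hgp : GenPos P)
    (hnonconst : ∃ p ∈ P, ∃ q ∈ P, c p ≠ c q) :
    IsRTS P c (relPts P c) ∧
      ∀ Q : Set (EuclideanSpace ℝ (Fin d)), IsRTS P c Q →
        relPts P c ⊆ Q ∧ (relPts P c).ncard ≤ Q.ncard ∧
          (Q.ncard = (relPts P c).ncard → Q = relPts P c) := by
  obtain ⟨hcol, hcyc⟩ := hgp
  have hmem : ∀ Q ⊆ P, nnClass Q c = nnClass P c → wallPts P c ⊆ Q := fun Q hQP hQ =>
    wallPts_subset_of_image_nearestPts_eq hfin hcol hcyc hQP (nnClass_eq_iff.1 hQ)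
  have hwP : wallPts P c ⊆ P := hmem P subset_rfl rfl
  have hwne : (wallPts P c).Nonempty := by
    obtain ⟨p, hp, q, hq, hc⟩ := hnonconst
    obtain ⟨z, -, r₁, r₂, hr, hcr⟩ := exists_nearestPts_eq_pair c hfin hcol isOpen_univ convex_univ
      (mem_univ p) (mem_univ q) ⟨hp, fun p' _ => by simp⟩ ⟨hq, fun p' _ => by simp⟩ hc
    exact ⟨r₁, z, r₂, hr, hcr⟩
  have hsuf : ∀ Q ⊆ P, wallPts P c ⊆ Q → nnClass Q c = nnClass P c := fun Q hQP hW =>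
    nnClass_eq_iff.2 (image_nearestPts_eq_of_wallPts_subset hfin hcol hQP (hwne.mono hW) hW)
  have hrel : relPts P c = wallPts P c := by
    ext p
    constructor
    · rintro ⟨-, h⟩
      by_contra hpw
      exact h (hsuf _ sdiff_subset (subset_sdiff_singleton hwP hpw))
    · exact fun hp => ⟨hwP hp, fun h => (hmem _ sdiff_subset h hp).2 rfl⟩
  rw [hrel]
  refine ⟨⟨hwP, hsuf _ hwP subset_rfl⟩, fun Q hQ => ?_⟩
  have hsub := hmem Q hQ.1 hQ.2
  have hQf := hfin.subset hQ.1
  exact ⟨hsub, ncard_le_ncard hsub hQf, fun h => (eq_of_subset_of_ncard_le hsub h.le hQf).symm⟩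
end

section
/- Let a, b, c, d ∈ ℝ^d with a ≠ b and c ≠ d, suppose a, b, c are not collinear, and suppose bis(a,b) = bis(c,d). Then a, b, c, d are cospherical: there exists a point z ∈ ℝ^d with dist(z,a) = dist(z,b) = dist(z,c) = dist(z,d). -/
open Set

/-- If `a, b, c` are not collinear and `bis(a,b) = bis(c,d)`, then `a, b, c, d`
are cospherical. -/
theorem cospherical_of_bis_eq {d : ℕ} (hd : 1 ≤ d)
    (a b c e : EuclideanSpace ℝ (Fin d)) (hab : a ≠ b) (hce : c ≠ e)
    (hncol : ¬ Collinear ℝ ({a, b, c} : Set (EuclideanSpace ℝ (Fin d))))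
    (hbis : bis a b = bis c e) :
    ∃ z : EuclideanSpace ℝ (Fin d),
      dist z a = dist z b ∧ dist z b = dist z c ∧ dist z c = dist z e := by
  have hind : AffineIndependent ℝ ![a, b, c] :=
    affineIndependent_iff_not_collinear_set.mpr hncol
  let t : Affine.Simplex ℝ (EuclideanSpace ℝ (Fin d)) 2 := ⟨![a, b, c], hind⟩
  have ha : dist t.circumcenter a = t.circumradius := t.dist_circumcenter_eq_circumradius' 0
  have hb : dist t.circumcenter b = t.circumradius := t.dist_circumcenter_eq_circumradius' 1
  have hc : dist t.circumcenter c = t.circumradius := t.dist_circumcenter_eq_circumradius' 2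
  have hz : t.circumcenter ∈ bis c e := hbis ▸ (ha.trans hb.symm : t.circumcenter ∈ bis a b)
  exact ⟨t.circumcenter, ha.trans hb.symm, hb.trans hc.symm, hz⟩
end

section
/- Let a, b, c, d ∈ ℝ^d with a ≠ b and c ≠ d, suppose a, b, c are not collinear, and suppose bis(a,b) = bis(c,d). Then the four points are concyclic: the set {a,b,c,d} is coplanar and there exists a point equidistant from all four of them. -/
open Set

/-- If `bis a b = bis c e`, then `e - c` is a multiple of `b - a`. -/
theorem exists_smul_sub_eq_of_bis_eq {d : ℕ} {a b c e : EuclideanSpace ℝ (Fin d)}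
    (hbis : bis a b = bis c e) : ∃ k : ℝ, k • (b - a) = e - c := by
  have h : AffineSubspace.perpBisector a b = AffineSubspace.perpBisector c e := by
    ext x
    rw [AffineSubspace.mem_perpBisector_iff_dist_eq, AffineSubspace.mem_perpBisector_iff_dist_eq]
    exact Set.ext_iff.mp hbis x
  have hdir := congrArg AffineSubspace.direction h
  rw [AffineSubspace.direction_perpBisector, AffineSubspace.direction_perpBisector] at hdir
  have hspan := congrArg Submodule.orthogonal hdir
  rw [Submodule.orthogonal_orthogonal, Submodule.orthogonal_orthogonal] at hspan
  have hmem : e - c ∈ Submodule.span ℝ {b - a} := by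
    have := Submodule.mem_span_singleton_self (R := ℝ) (e -ᵥ c)
    rwa [← hspan] at this
  exact Submodule.mem_span_singleton.mp hmem

/-- Three noncollinear points have an equidistant point. -/
theorem exists_dist_eq_of_not_collinear {d : ℕ} {a b c : EuclideanSpace ℝ (Fin d)}
    (h : ¬ Collinear ℝ ({a, b, c} : Set (EuclideanSpace ℝ (Fin d)))) :
    ∃ o r, dist a o = r ∧ dist b o = r ∧ dist c o = r := by
  let s : Affine.Simplex ℝ (EuclideanSpace ℝ (Fin d)) 2 :=
    ⟨![a, b, c], affineIndependent_iff_not_collinear_set.mpr h⟩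
  exact ⟨s.circumcenter, s.circumradius, s.dist_circumcenter_eq_circumradius 0,
    s.dist_circumcenter_eq_circumradius 1, s.dist_circumcenter_eq_circumradius 2⟩

/-- If `a, b, c` are not collinear and `bis(a,b) = bis(c,d)`, then `a, b, c, d`
are concyclic. -/
theorem concyclic_of_bis_eq {d : ℕ} (hd : 1 ≤ d)
    (a b c e : EuclideanSpace ℝ (Fin d)) (hab : a ≠ b) (hce : c ≠ e)
    (hncol : ¬ Collinear ℝ ({a, b, c} : Set (EuclideanSpace ℝ (Fin d))))
    (hbis : bis a b = bis c e) :
    EuclideanGeometry.Concyclic ({a, b, c, e} : Set (EuclideanSpace ℝ (Fin d))) := by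
  obtain ⟨k, hk⟩ := exists_smul_sub_eq_of_bis_eq hbis
  obtain ⟨o, r, ha, hb, hc⟩ := exists_dist_eq_of_not_collinear hncol
  have he : dist e o = r := by
    have ho : o ∈ bis c e := by
      rw [← hbis]
      change dist o a = dist o b
      rw [dist_comm o, dist_comm o, ha, hb]
    rw [← hc, dist_comm e, dist_comm c]
    exact ho.symm
  refine ⟨⟨o, r, by simp [ha, hb, hc, he]⟩, ?_⟩
  have hmem : e ∈ affineSpan ℝ ({a, b, c} : Set (EuclideanSpace ℝ (Fin d))) := by
    have hspan := AffineSubspace.smul_vsub_vadd_mem (affineSpan ℝ {a, b, c}) k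
      (mem_affineSpan ℝ (show b ∈ ({a, b, c} : Set _) by simp))
      (mem_affineSpan ℝ (show a ∈ ({a, b, c} : Set _) by simp))
      (mem_affineSpan ℝ (show c ∈ ({a, b, c} : Set _) by simp))
    simpa [hk] using hspan
  have hset : ({a, b, c, e} : Set (EuclideanSpace ℝ (Fin d))) = insert e {a, b, c} := by
    ext x
    simp only [mem_insert_iff, mem_singleton_iff]
    tauto
  rw [hset, coplanar_insert_iff_of_mem_affineSpan hmem]
  exact coplanar_triple ℝ a b c
end
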